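/- Let i be an item and let r = X → Y be any totally-ordered sequential rule over a sequence database D such that i occurs in X or in Y. Then u(r) ≤ SEU(i). Consequently, for any threshold minutil, if SEU(i) < minutil then u(r) < minutil, so no ToSR whose antecedent or consequent contains an unpromising item can be high-utility. -/

import Mathlib

open scoped Classical

noncomputable section

namespace TotalSR

variable {I : Type*} [LinearOrder I]

/-- A sequence: a list of itemsets. -/
abbrev Seqc (I : Type*) := List (Finset I)

/-- The set of items occurring in a sequence. -/
def itemsOf (s : Seqc I) : Finset I := s.foldr (· ∪ ·) ∅

/-- Well-formed sequence: nonempty, all itemsets nonempty, and each item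
occurs at most once (itemsets pairwise disjoint). -/
def WFSeq (s : Seqc I) : Prop :=
  s ≠ [] ∧ (∀ e ∈ s, e.Nonempty) ∧ s.Pairwise fun a b => Disjoint a b

/-- `s₁` occurs in `s₂` (written s₁ ⊑ s₂): there exist strictly increasing
indices matching each itemset of `s₁` into a superset itemset of `s₂`. -/
def OccursIn (s₁ s₂ : Seqc I) : Prop :=
  ∃ t : List (Finset I), t.Sublist s₂ ∧ List.Forall₂ (· ⊆ ·) s₁ t

/-- The rule X → Y occurs in s: there is a split position 1 ≤ k < |s|
with X occurring in the first k itemsets and Y in the remaining ones. -/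
def RuleOccursIn (X Y s : Seqc I) : Prop :=
  ∃ k, 1 ≤ k ∧ k < s.length ∧ OccursIn X (s.take k) ∧ OccursIn Y (s.drop k)

/-- seq(r): the sequences of the database D in which the rule X → Y occurs. -/
def seqL (D : List (Seqc I)) (X Y : Seqc I) : List (Seqc I) :=
  D.filter fun s => decide (RuleOccursIn X Y s)

/-- ant(r): the sequences of the database D in which the antecedent X occurs. -/
def antL (D : List (Seqc I)) (X : Seqc I) : List (Seqc I) :=
  D.filter fun s => decide (OccursIn X s)

/-- conf(r) = |seq(r)| / |ant(r)|. -/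
def conf (D : List (Seqc I)) (X Y : Seqc I) : ℝ :=
  ((seqL D X Y).length : ℝ) / ((antL D X).length : ℝ)

variable (q : I → Seqc I → ℝ) (iu : I → ℝ)

/-- u(i, s) = q(i, s) · iu(i). -/
def itemUtil (j : I) (s : Seqc I) : ℝ := q j s * iu j

/-- u(r, s): the sum of u(i, s) over all items occurring in X or Y. -/
def ruleUtilIn (X Y s : Seqc I) : ℝ :=
  ∑ j ∈ itemsOf X ∪ itemsOf Y, itemUtil q iu j s

/-- u(r) = Σ_{s ∈ seq(r)} u(r, s). -/
def ruleUtil (D : List (Seqc I)) (X Y : Seqc I) : ℝ :=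
  ((seqL D X Y).map (ruleUtilIn q iu X Y)).sum

/-- I-extension of a sequence: insert item i into the last itemset. -/
def iExt (X : Seqc I) (i : I) : Seqc I := X.dropLast ++ [insert i (X.getLastD ∅)]

/-- S-extension of a sequence: append the singleton itemset {i}. -/
def sExt (X : Seqc I) (i : I) : Seqc I := X ++ [{i}]

/-- X' is obtained from the rule X → Y by a left I- or S-expansion with item i. -/
def IsLeftExp (X Y : Seqc I) (i : I) (X' : Seqc I) : Prop :=
  i ∉ itemsOf Y ∧
    ((X' = iExt X i ∧ ∀ a ∈ X.getLastD ∅, a < i) ∨ X' = sExt X i)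

/-- Y' is obtained from the rule X → Y by a right I- or S-expansion with item i. -/
def IsRightExp (X Y : Seqc I) (i : I) (Y' : Seqc I) : Prop :=
  i ∉ itemsOf X ∧
    ((Y' = iExt Y i ∧ ∀ a ∈ Y.getLastD ∅, a < i) ∨ Y' = sExt Y i)

/-- ULeft(r, s): sum of u(j, s) over items j of s such that some left
expansion of r with j occurs in s. -/
def ULeft (X Y s : Seqc I) : ℝ :=
  ∑ j ∈ (itemsOf s).filter
      (fun j => ∃ X', IsLeftExp X Y j X' ∧ RuleOccursIn X' Y s),
    itemUtil q iu j s

/-- LEPEU(r, s). -/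
def LEPEUs (X Y s : Seqc I) : ℝ :=
  if 0 < ULeft q iu X Y s then ruleUtilIn q iu X Y s + ULeft q iu X Y s else 0

/-- LEPEU(r) = Σ_{s ∈ seq(r)} LEPEU(r, s). -/
def LEPEU (D : List (Seqc I)) (X Y : Seqc I) : ℝ :=
  ((seqL D X Y).map (LEPEUs q iu X Y)).sum

/-- URight(r, s): sum of u(j, s) over items j of s such that some right
expansion of r with j occurs in s. -/
def URight (X Y s : Seqc I) : ℝ :=
  ∑ j ∈ (itemsOf s).filter
      (fun j => ∃ Y', IsRightExp X Y j Y' ∧ RuleOccursIn X Y' s),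
    itemUtil q iu j s

/-- REPEU(r, s). -/
def REPEUs (X Y s : Seqc I) : ℝ :=
  if 0 < URight q iu X Y s then ruleUtilIn q iu X Y s + URight q iu X Y s else 0

/-- REPEU(r) = Σ_{s ∈ seq(r)} REPEU(r, s). -/
def REPEU (D : List (Seqc I)) (X Y : Seqc I) : ℝ :=
  ((seqL D X Y).map (REPEUs q iu X Y)).sum

/-- j occurs strictly after i in s: in a strictly later itemset, or in the
same itemset and strictly greater in the item order. -/
def AfterIn (s : Seqc I) (i j : I) : Prop :=
  ∃ a b : Fin s.length, i ∈ s.get a ∧ j ∈ s.get b ∧ (a < b ∨ (a = b ∧ i < j))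

/-- UILeft(r, i, s): u(i, s) plus the sum of u(j, s) over items j of s
occurring strictly after i such that some left expansion of r with j occurs in s. -/
def UILeft (X Y : Seqc I) (i : I) (s : Seqc I) : ℝ :=
  itemUtil q iu i s +
    ∑ j ∈ (itemsOf s).filter
        (fun j => AfterIn s i j ∧ ∃ X', IsLeftExp X Y j X' ∧ RuleOccursIn X' Y s),
      itemUtil q iu j s

/-- LERSPEU(r') = Σ_{s ∈ seq(r')} (u(r, s) + UILeft(r, i, s)), where r' = X⋄i → Y. -/
def LERSPEU (D : List (Seqc I)) (X Y : Seqc I) (i : I) (X' : Seqc I) : ℝ :=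
  ((seqL D X' Y).map fun s => ruleUtilIn q iu X Y s + UILeft q iu X Y i s).sum

/-- UIRight(r, i, s): u(i, s) plus the sum of u(j, s) over items j of s
occurring strictly after i in s. -/
def UIRight (i : I) (s : Seqc I) : ℝ :=
  itemUtil q iu i s +
    ∑ j ∈ (itemsOf s).filter (fun j => AfterIn s i j), itemUtil q iu j s

/-- RERSPEU(r') = Σ_{s ∈ seq(r')} (u(r, s) + UIRight(r, i, s)), where r' = X → Y⋄i. -/
def RERSPEU (D : List (Seqc I)) (X Y : Seqc I) (i : I) (Y' : Seqc I) : ℝ :=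
  ((seqL D X Y').map fun s => ruleUtilIn q iu X Y s + UIRight q iu i s).sum

/-- The total utility of all items occurring in a sequence. -/
def totalUtil (s : Seqc I) : ℝ := ∑ j ∈ itemsOf s, itemUtil q iu j s

/-- SEU(i): sum, over the sequences of D in which item i occurs, of the
total utility of the sequence. -/
def SEUitem (D : List (Seqc I)) (i : I) : ℝ :=
  ((D.filter fun s => decide (i ∈ itemsOf s)).map (totalUtil q iu)).sum

/-- SEU(r): sum, over the sequences of D in which the rule r occurs, of the
total utility of the sequence. -/
def SEUrule (D : List (Seqc I)) (X Y : Seqc I) : ℝ :=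
  ((seqL D X Y).map (totalUtil q iu)).sum

/-- One expansion step on rules (as pairs (antecedent, consequent)):
either a left I- or S-expansion or a right I- or S-expansion with some item. -/
def ExpStep (p p' : Seqc I × Seqc I) : Prop :=
  (∃ i, IsLeftExp p.1 p.2 i p'.1 ∧ p'.2 = p.2) ∨
    (∃ i, IsRightExp p.1 p.2 i p'.2 ∧ p'.1 = p.1)

theorem mem_itemsOf {s : Seqc I} {j : I} : j ∈ itemsOf s ↔ ∃ e ∈ s, j ∈ e := by
  induction s with
  | nil => simp [itemsOf]
  | cons a l ih =>
    change j ∈ a ∪ itemsOf l ↔ _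
    simp [ih]

theorem OccursIn.itemsOf_subset {s t : Seqc I} (h : OccursIn s t) :
    itemsOf s ⊆ itemsOf t := by
  obtain ⟨u, hu, hsu⟩ := h
  intro j hj
  obtain ⟨e, he, hje⟩ := mem_itemsOf.1 hj
  obtain ⟨n, hn, rfl⟩ := List.getElem_of_mem he
  have hn' : n < u.length := hsu.length_eq ▸ hn
  exact mem_itemsOf.2 ⟨u[n], hu.subset (List.getElem_mem hn'), hsu.get hn hn' hje⟩

theorem RuleOccursIn.itemsOf_union_subset {X Y s : Seqc I} (h : RuleOccursIn X Y s) :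
    itemsOf X ∪ itemsOf Y ⊆ itemsOf s := by
  obtain ⟨k, -, -, hX, hY⟩ := h
  have mono {t : Seqc I} (ht : t ⊆ s) : itemsOf t ⊆ itemsOf s := fun j hj =>
    let ⟨e, he, hje⟩ := mem_itemsOf.1 hj
    mem_itemsOf.2 ⟨e, ht he, hje⟩
  exact Finset.union_subset (hX.itemsOf_subset.trans (mono (List.take_subset k s)))
    (hY.itemsOf_subset.trans (mono (List.drop_subset k s)))

theorem sum_map_filter_le_sum_map_filter {α : Type*} {p r : α → Prop}
    [DecidablePred p] [DecidablePred r] {f g : α → ℝ}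
    (l : List α) (hpr : ∀ a, p a → r a) (hfg : ∀ a, p a → f a ≤ g a)
    (hg : ∀ a, 0 ≤ g a) :
    ((l.filter fun a => decide (p a)).map f).sum ≤
      ((l.filter fun a => decide (r a)).map g).sum := by
  induction l with
  | nil => simp
  | cons a l ih =>
    by_cases hp : p a
    · simpa [hp, hpr a hp] using add_le_add (hfg a hp) ih
    · by_cases hr : r a
      · simpa [hp, hr] using ih.trans (le_add_of_nonneg_left (hg a))
      · simpa [hp, hr] using ih

/-- if item i occurs in the antecedent or consequent of a ToSR
r = X → Y, then u(r) ≤ SEU(i); consequently, if SEU(i) < minutil then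
u(r) < minutil. -/
theorem utility_le_SEU_of_item_mem
    (hiu : ∀ j : I, 0 < iu j)
    (hq : ∀ (j : I) (s : Seqc I), j ∈ itemsOf s → 0 < q j s)
    (D : List (Seqc I)) (hD : ∀ s ∈ D, WFSeq s)
    (X Y : Seqc I) (hX : WFSeq X) (hY : WFSeq Y)
    (hXY : Disjoint (itemsOf X) (itemsOf Y))
    (i : I) (hi : i ∈ itemsOf X ∪ itemsOf Y) :
    ruleUtil q iu D X Y ≤ SEUitem q iu D i ∧
    ∀ minutil : ℝ, SEUitem q iu D i < minutil → ruleUtil q iu D X Y < minutil := by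
  have key : ruleUtil q iu D X Y ≤ SEUitem q iu D i := by
    have hu (s : Seqc I) (j : I) (hj : j ∈ itemsOf s) : 0 ≤ itemUtil q iu j s :=
      (mul_pos (hq j s hj) (hiu j)).le
    exact sum_map_filter_le_sum_map_filter
      (p := RuleOccursIn X Y) (r := fun s => i ∈ itemsOf s)
      (f := ruleUtilIn q iu X Y) (g := totalUtil q iu) D
      (fun s hs => hs.itemsOf_union_subset hi)
      (fun s hs => Finset.sum_le_sum_of_subset_of_nonneg hs.itemsOf_union_subset
        fun j hj _ => hu s j hj)
      (fun s => Finset.sum_nonneg (hu s))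
  exact ⟨key, fun _ h => key.trans_lt h⟩


end TotalSR
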